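/- There is no real polynomial P of degree 8 that defines the sign pattern (+,+,−,+,−,−,−,−,+), has no negative real roots, and has exactly four positive real roots, each simple. In other words, the sign pattern (+,+,−,+,−,−,−,−,+) is not realizable with the admissible pair (4,0). -/

import Mathlib

open Polynomial

/-- A degree-8 real polynomial `P` defines the sign pattern `σ = (σ_0, …, σ_8)`
(with entries `1` for `+`, `-1` for `−`) if for each `j` the coefficient of
`x^(8-j)` is nonzero and has sign `σ_j`. -/
def definesSignPattern (P : Polynomial ℝ) (σ : Fin 9 → ℝ) : Prop :=
  ∀ j : Fin 9, Real.sign (P.coeff (8 - (j : ℕ))) = σ j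

/-- An octic `P` vanishing at `0 < a < b < 1` and at `1`, with leading coefficients `p₈, p₇ > 0`,
with `p₄, p₃, p₂ < 0` and `p₀ > 0`, is nonpositive at `-1`. For suitable `μ` and `ν > 0`, every
coefficient of `-b (1 - b⁴) P(a) + a (1 - a⁴) P(b) - μ P(1) + ν P(-1)`, as a linear form in the
`pᵢ`, either vanishes or has sign opposite to that of `pᵢ`. -/
lemma octic_eval_neg_one_nonpos {a b p₀ p₁ p₂ p₃ p₄ p₅ p₆ p₇ p₈ : ℝ}
    (ha : 0 < a) (hab : a < b) (hb : b < 1)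
    (h₀ : 0 < p₀) (h₂ : p₂ < 0) (h₃ : p₃ < 0) (h₄ : p₄ < 0) (h₇ : 0 < p₇) (h₈ : 0 < p₈)
    (hPa : p₀ + p₁ * a + p₂ * a ^ 2 + p₃ * a ^ 3 + p₄ * a ^ 4 + p₅ * a ^ 5 + p₆ * a ^ 6
      + p₇ * a ^ 7 + p₈ * a ^ 8 = 0)
    (hPb : p₀ + p₁ * b + p₂ * b ^ 2 + p₃ * b ^ 3 + p₄ * b ^ 4 + p₅ * b ^ 5 + p₆ * b ^ 6
      + p₇ * b ^ 7 + p₈ * b ^ 8 = 0)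
    (hP1 : p₀ + p₁ + p₂ + p₃ + p₄ + p₅ + p₆ + p₇ + p₈ = 0) :
    p₀ - p₁ + p₂ - p₃ + p₄ - p₅ + p₆ - p₇ + p₈ ≤ 0 := by
  have hb0 : 0 < b := ha.trans hab
  have hba : 0 < b - a := sub_pos.2 hab
  have h1a : 0 < 1 - a := by linarith
  have h1b : 0 < 1 - b := by linarith
  have hpow (n : ℕ) (hn : n ≠ 0) : 0 < b ^ n - a ^ n :=
    sub_pos.2 (pow_lt_pow_left₀ hab ha.le hn)
  have hA : 0 < 1 - a ^ 2 := by nlinarith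
  have hB : 0 < 1 - b ^ 2 := by nlinarith
  have hAB : 0 < 1 - a * b := by nlinarith
  have hd1 := hpow 1 one_ne_zero
  have hd2 := hpow 2 two_ne_zero
  have hd3 := hpow 3 three_ne_zero
  have hd4 := hpow 4 four_ne_zero
  have hd5 := hpow 5 (by norm_num)
  have c₀ : 0 < (1 - a ^ 2) * (1 - b ^ 2) *
      ((b - a) * (1 - a * b) * ((1 + a ^ 2) * (1 + b ^ 2) + a * b)) := by positivity
  have c₂ : 0 < a * b * ((1 - a ^ 2) * (1 + a ^ 2) * ((1 - b ^ 2) * (1 + b ^ 2)) * (b - a)) := by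
    positivity
  have c₄ : 0 < a * b * ((1 - a ^ 2) * (1 - b ^ 2) *
      ((b ^ 3 - a ^ 3) + a ^ 2 * b ^ 2 * (b - a))) := by positivity
  have c₈ : 0 < a * b * ((1 - a ^ 2) * (1 - b ^ 2) *
      ((b ^ 5 - a ^ 5) + a ^ 2 * b ^ 2 * (b ^ 3 - a ^ 3))) := by positivity
  have c₃ : 0 < a * b * ((b ^ 2 - a ^ 2) * (1 - a ^ 2) * (1 - b ^ 2)) := by positivity
  have c₇ : 0 < a * b * ((b ^ 2 - a ^ 2) * ((1 - a ^ 2) * (1 - b ^ 2) *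
      (a ^ 2 + b ^ 2 + a ^ 2 * b ^ 2))) := by positivity
  have hν : 0 < a * b * ((1 - a) * (1 - b) * ((b ^ 4 - a ^ 4) + a * b * (b ^ 3 - a ^ 3)
      + a ^ 2 * b ^ 2 * (b ^ 2 - a ^ 2) + a ^ 3 * b ^ 3 * (b - a))) := by positivity
  have t₀ := mul_pos h₀ c₀
  have t₂ := mul_pos (neg_pos.2 h₂) c₂
  have t₃ := mul_pos (neg_pos.2 h₃) c₃
  have t₄ := mul_pos (neg_pos.2 h₄) c₄
  have t₇ := mul_pos h₇ c₇
  have t₈ := mul_pos h₈ c₈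
  by_contra! hneg
  have tν := mul_pos hν hneg
  have ea := congrArg (b * (1 - b ^ 4) * ·) hPa
  have eb := congrArg (a * (1 - a ^ 4) * ·) hPb
  have e1 := congrArg
    (a * b * (b ^ 4 - a ^ 4 + (b ^ 5 * (1 - a ^ 4) - a ^ 5 * (1 - b ^ 4))) * ·) hP1
  simp only [mul_zero] at ea eb e1
  linarith

/-- The given sign pattern is not realizable with the admissible pair (4,0):
there is no degree 8 real polynomial defining this pattern, with no negative
real roots and exactly four positive real roots, each simple. -/
theorem stmt5 :
    ¬ ∃ P : Polynomial ℝ, P.degree = 8 ∧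
      definesSignPattern P ![1, 1, -1, 1, -1, -1, -1, -1, 1] ∧
      (∀ x : ℝ, x < 0 → P.eval x ≠ 0) ∧
      ∃ z : Fin 4 → ℝ, StrictMono z ∧ (∀ i, 0 < z i) ∧
        (∀ i, P.eval (z i) = 0) ∧ (∀ i, P.rootMultiplicity (z i) = 1) ∧
        (∀ x : ℝ, 0 < x → P.eval x = 0 → ∃ i, x = z i) := by
  rintro ⟨P, hdeg, hσ, hneg, z, hz, hz0, hPz, -, -⟩
  have hnat : P.natDegree = 8 := natDegree_eq_of_degree_eq_some hdeg
  have heval (x : ℝ) : P.eval x = P.coeff 0 + P.coeff 1 * x + P.coeff 2 * x ^ 2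
      + P.coeff 3 * x ^ 3 + P.coeff 4 * x ^ 4 + P.coeff 5 * x ^ 5 + P.coeff 6 * x ^ 6
      + P.coeff 7 * x ^ 7 + P.coeff 8 * x ^ 8 := by
    rw [eval_eq_sum_range, hnat]
    simp [Finset.sum_range_succ]
  have pos_of_sign {x : ℝ} (h : Real.sign x = 1) : 0 < x := by
    rcases lt_trichotomy x 0 with hx | rfl | hx
    · rw [Real.sign_of_neg hx] at h; norm_num at h
    · simp at h
    · exact hx
  have neg_of_sign {x : ℝ} (h : Real.sign x = -1) : x < 0 := by
    rw [← neg_pos]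
    exact pos_of_sign (by rw [Real.sign_neg, h, neg_neg])
  have h₈ : 0 < P.coeff 8 := pos_of_sign (hσ 0)
  have h₇ : 0 < P.coeff 7 := pos_of_sign (hσ 1)
  have h₄ : P.coeff 4 < 0 := neg_of_sign (hσ 4)
  have h₃ : P.coeff 3 < 0 := neg_of_sign (hσ 5)
  have h₂ : P.coeff 2 < 0 := neg_of_sign (hσ 6)
  have h₀ : 0 < P.coeff 0 := pos_of_sign (hσ 8)
  have hc : 0 < z 2 := hz0 2
  have hpos : 0 < P.eval (-z 2) := by
    by_contra! hle
    have h0 : 0 ≤ P.eval 0 := by rw [← coeff_zero_eq_eval_zero]; exact h₀.le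
    obtain ⟨x, hx, hx0⟩ := intermediate_value_Icc (by linarith : -z 2 ≤ 0)
      P.continuous.continuousOn ⟨hle, h0⟩
    rcases hx.2.lt_or_eq with hlt | rfl
    · exact hneg x hlt hx0
    · replace hx0 : P.eval 0 = 0 := hx0
      rw [← coeff_zero_eq_eval_zero] at hx0
      exact h₀.ne' hx0
  have hscale (x : ℝ) : P.eval x = P.coeff 0 + P.coeff 1 * z 2 * (x / z 2)
      + P.coeff 2 * z 2 ^ 2 * (x / z 2) ^ 2 + P.coeff 3 * z 2 ^ 3 * (x / z 2) ^ 3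
      + P.coeff 4 * z 2 ^ 4 * (x / z 2) ^ 4 + P.coeff 5 * z 2 ^ 5 * (x / z 2) ^ 5
      + P.coeff 6 * z 2 ^ 6 * (x / z 2) ^ 6 + P.coeff 7 * z 2 ^ 7 * (x / z 2) ^ 7
      + P.coeff 8 * z 2 ^ 8 * (x / z 2) ^ 8 := by
    rw [heval]
    field_simp
  have key := octic_eval_neg_one_nonpos (div_pos (hz0 0) hc)
    (div_lt_div_of_pos_right (hz (by decide : (0 : Fin 4) < 1)) hc)
    ((div_lt_one hc).2 (hz (by decide : (1 : Fin 4) < 2)))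
    h₀ (mul_neg_of_neg_of_pos h₂ (pow_pos hc 2)) (mul_neg_of_neg_of_pos h₃ (pow_pos hc 3))
    (mul_neg_of_neg_of_pos h₄ (pow_pos hc 4)) (mul_pos h₇ (pow_pos hc 7))
    (mul_pos h₈ (pow_pos hc 8)) ((hscale (z 0)).symm.trans (hPz 0))
    ((hscale (z 1)).symm.trans (hPz 1)) ((heval (z 2)).symm.trans (hPz 2))
  rw [heval] at hpos
  linarith
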